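/- arXiv:1401.7244 — 2 statements merged into one kernel-verified Lean document; each statement's English description precedes it below -/
import Mathlib

section
/- Let A have Jordan form ⊕_{i=1}^N J_{p_i}(λ_i) and B have Jordan form ⊕_{j=1}^M J_{r_j}(μ_j) in M_n(ℂ), and let Δ(T) = AT − TB be the generalized derivation on M_n(ℂ). Then rd_k(im Δ) = Σ_{i,j} R(i,j,k), where R(i,j,k) = min{p_i, r_j} − k if λ_i = μ_j and k < min{p_i, r_j}, and R(i,j,k) = 0 otherwise. -/
open Matrix

/-- The trace-pairing annihilator of a set of matrices. -/
def annih {α β : Type*} [Fintype α] [Fintype β] (S : Set (Matrix α β ℂ)) :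
    Set (Matrix β α ℂ) := {C | ∀ A ∈ S, (C * A).trace = 0}

/-- The algebraic `k`-reflexive cover `(S_⊥ ∩ F_k)_⊥`. -/
noncomputable def RefK {α β : Type*} [Fintype α] [Fintype β] (k : ℕ)
    (S : Set (Matrix α β ℂ)) : Set (Matrix α β ℂ) :=
  annih {C | C ∈ annih S ∧ C.rank ≤ k}

/-- The `k`-reflexivity defect. -/
noncomputable def rdK {α β : Type*} [Fintype α] [Fintype β] (k : ℕ)
    (S : Set (Matrix α β ℂ)) : ℕ :=
  Module.finrank ℂ (Submodule.span ℂ (RefK k S)) -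
    Module.finrank ℂ (Submodule.span ℂ S)

/-- The `m × m` Jordan block with eigenvalue `lam`. -/
def JB (m : ℕ) (lam : ℂ) : Matrix (Fin m) (Fin m) ℂ :=
  Matrix.of fun i j => if (j : ℕ) = (i : ℕ) + 1 then 1 else if j = i then lam else 0

/-- Upper triangular Toeplitz matrices: entry `(i,j)` depends only on `j - i`,
and vanishes when `j < i`. -/
def UTToeplitz (m : ℕ) : Set (Matrix (Fin m) (Fin m) ℂ) :=
  {C | (∀ i j : Fin m, (j : ℕ) < (i : ℕ) → C i j = 0) ∧
    ∀ i j i' j' : Fin m, (i : ℕ) + (j' : ℕ) = (i' : ℕ) + (j : ℕ) → C i j = C i' j'}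

section Duality

variable {α β : Type*} [Fintype α] [Fintype β]

/-- The functional `X ↦ tr (C X)` attached to a matrix `C`. -/
noncomputable def traceDual (α β : Type*) [Fintype α] [Fintype β] :
    Matrix β α ℂ →ₗ[ℂ] Module.Dual ℂ (Matrix α β ℂ) :=
  LinearMap.mk₂ ℂ (fun C X => (C * X).trace)
    (fun _ _ _ => by rw [Matrix.add_mul, trace_add])
    (fun _ _ _ => by rw [Matrix.smul_mul, trace_smul])
    (fun _ _ _ => by rw [Matrix.mul_add, trace_add])
    (fun _ _ _ => by rw [Matrix.mul_smul, trace_smul])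

theorem traceDual_injective : Function.Injective (traceDual α β) := fun _ _ h =>
  Matrix.ext_iff_trace_mul_right.2 fun X => LinearMap.congr_fun h X

/-- The trace pairing identifies `Matrix β α ℂ` with the dual of `Matrix α β ℂ`. -/
noncomputable def traceDualEquiv (α β : Type*) [Fintype α] [Fintype β] :
    Matrix β α ℂ ≃ₗ[ℂ] Module.Dual ℂ (Matrix α β ℂ) :=
  LinearEquiv.ofInjectiveOfFinrankEq (traceDual α β) traceDual_injective (by
    rw [Subspace.dual_finrank_eq, Module.finrank_matrix, Module.finrank_matrix]
    ring)

theorem traceDualEquiv_apply (C : Matrix β α ℂ) (X : Matrix α β ℂ) :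
    traceDualEquiv α β C X = (C * X).trace := rfl

theorem annih_eq_comap (S : Set (Matrix α β ℂ)) :
    annih S = ((Submodule.span ℂ S).dualAnnihilator.comap
      (traceDualEquiv α β : Matrix β α ℂ →ₗ[ℂ] _) : Set (Matrix β α ℂ)) := by
  ext C
  simp only [annih, Set.mem_ofPred_eq, SetLike.mem_coe, Submodule.mem_comap,
    Submodule.mem_dualAnnihilator]
  constructor
  · intro h X hX
    have : Submodule.span ℂ S ≤ LinearMap.ker (traceDualEquiv α β C) :=
      Submodule.span_le.2 fun X hX => h X hX
    exact this hX
  · intro h X hX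
    exact h X (Submodule.subset_span hX)

theorem finrank_span_annih (S : Set (Matrix α β ℂ)) :
    Module.finrank ℂ (Submodule.span ℂ S) + Module.finrank ℂ (Submodule.span ℂ (annih S)) =
      Module.finrank ℂ (Matrix α β ℂ) := by
  rw [annih_eq_comap, Submodule.span_eq, Submodule.comap_equiv_eq_map_symm,
    LinearEquiv.finrank_map_eq]
  exact Subspace.finrank_add_finrank_dualAnnihilator_eq _

theorem rdK_eq (k : ℕ) (S : Set (Matrix α β ℂ)) :
    rdK k S = Module.finrank ℂ (Submodule.span ℂ (annih S)) -
      Module.finrank ℂ (Submodule.span ℂ {C | C ∈ annih S ∧ C.rank ≤ k}) := by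
  have h₁ := finrank_span_annih S
  have h₂ := finrank_span_annih {C | C ∈ annih S ∧ C.rank ≤ k}
  have h₃ : Module.finrank ℂ (Matrix α β ℂ) = Module.finrank ℂ (Matrix β α ℂ) := by
    rw [Module.finrank_matrix, Module.finrank_matrix]
    ring
  rw [rdK, RefK]
  omega

end Duality

section Intertwiner

variable {α β : Type*} [Fintype α] [Fintype β]

/-- The matrices `C` with `C A = B C`. -/
def intertwiner (A : Matrix α α ℂ) (B : Matrix β β ℂ) : Submodule ℂ (Matrix β α ℂ) where
  carrier := {C | C * A = B * C}
  add_mem' {C D} hC hD := by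
    simp only [Set.mem_ofPred_eq] at *
    rw [Matrix.add_mul, Matrix.mul_add, hC, hD]
  zero_mem' := by simp
  smul_mem' c C hC := by
    simp only [Set.mem_ofPred_eq] at *
    rw [Matrix.smul_mul, Matrix.mul_smul, hC]

theorem mem_intertwiner {A : Matrix α α ℂ} {B : Matrix β β ℂ} {C : Matrix β α ℂ} :
    C ∈ intertwiner A B ↔ C * A = B * C := Iff.rfl

theorem annih_range_derivation (A : Matrix α α ℂ) (B : Matrix β β ℂ) :
    annih (Set.range fun T : Matrix α β ℂ => A * T - T * B) = intertwiner A B := by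
  ext C
  simp only [annih, Set.mem_ofPred_eq, Set.forall_mem_range, SetLike.mem_coe, mem_intertwiner]
  rw [Matrix.ext_iff_trace_mul_right]
  refine forall_congr' fun T => ?_
  rw [Matrix.mul_sub, trace_sub, sub_eq_zero, ← Matrix.mul_assoc, ← Matrix.mul_assoc,
    trace_mul_comm (C * T) B, ← Matrix.mul_assoc]

variable {α' β' : Type*} [DecidableEq α] [DecidableEq β]

/-- The change of coordinates `C ↦ Q⁻¹ C P` followed by a relabelling of the indices. -/
noncomputable def changeCoords {P : Matrix α α ℂ} {Q : Matrix β β ℂ} (hP : IsUnit P)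
    (hQ : IsUnit Q) (eA : α' ≃ α) (eB : β' ≃ β) : Matrix β α ℂ ≃ₗ[ℂ] Matrix β' α' ℂ where
  toFun C := (Q⁻¹ * C * P).submatrix eB eA
  invFun D := Q * D.submatrix eB.symm eA.symm * P⁻¹
  map_add' C D := by rw [Matrix.mul_add, Matrix.add_mul]; rfl
  map_smul' c C := by rw [Matrix.mul_smul, Matrix.smul_mul]; rfl
  left_inv C := by
    rw [isUnit_iff_isUnit_det] at hP hQ
    simp only [submatrix_submatrix, Equiv.self_comp_symm, submatrix_id_id]
    rw [← Matrix.mul_assoc, mul_nonsing_inv_cancel_right _ _ hP,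
      mul_nonsing_inv_cancel_left _ _ hQ]
  right_inv D := by
    rw [isUnit_iff_isUnit_det] at hP hQ
    dsimp only
    rw [Matrix.mul_assoc Q, nonsing_inv_mul_cancel_left _ _ hQ,
      nonsing_inv_mul_cancel_right _ _ hP]
    simp

theorem changeCoords_apply {P : Matrix α α ℂ} {Q : Matrix β β ℂ} (hP : IsUnit P)
    (hQ : IsUnit Q) (eA : α' ≃ α) (eB : β' ≃ β) (C : Matrix β α ℂ) :
    changeCoords hP hQ eA eB C = (Q⁻¹ * C * P).submatrix eB eA := rfl

variable [Fintype α']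

theorem rank_changeCoords {P : Matrix α α ℂ} {Q : Matrix β β ℂ} (hP : IsUnit P)
    (hQ : IsUnit Q) (eA : α' ≃ α) (eB : β' ≃ β) (C : Matrix β α ℂ) :
    (changeCoords hP hQ eA eB C).rank = C.rank := by
  rw [changeCoords_apply, rank_submatrix,
    rank_mul_eq_left_of_isUnit_det _ _ ((isUnit_iff_isUnit_det _).1 hP),
    rank_mul_eq_right_of_isUnit_det _ _
      (isUnit_nonsing_inv_det _ ((isUnit_iff_isUnit_det _).1 hQ))]

variable [Fintype β']

theorem changeCoords_mem_intertwiner {P : Matrix α α ℂ} {Q : Matrix β β ℂ} (hP : IsUnit P)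
    (hQ : IsUnit Q) (eA : α' ≃ α) (eB : β' ≃ β) (A' : Matrix α' α' ℂ) (B' : Matrix β' β' ℂ)
    (C : Matrix β α ℂ) :
    changeCoords hP hQ eA eB C ∈ intertwiner A' B' ↔
      C ∈ intertwiner (P * reindex eA eA A' * P⁻¹) (Q * reindex eB eB B' * Q⁻¹) := by
  obtain ⟨D, rfl⟩ := (changeCoords hP hQ eA eB).symm.surjective C
  rw [LinearEquiv.apply_symm_apply]
  change _ ↔ Q * D.submatrix eB.symm eA.symm * P⁻¹ ∈ _
  rw [isUnit_iff_isUnit_det] at hP hQ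
  simp only [mem_intertwiner, reindex_apply]
  have h₁ : Q * D.submatrix eB.symm eA.symm * P⁻¹ * (P * A'.submatrix eA.symm eA.symm * P⁻¹) =
      Q * (D * A').submatrix eB.symm eA.symm * P⁻¹ := by
    rw [← submatrix_mul_equiv _ _ _ eA.symm]
    simp only [Matrix.mul_assoc]
    rw [nonsing_inv_mul_cancel_left _ _ hP]
  have h₂ : Q * B'.submatrix eB.symm eB.symm * Q⁻¹ * (Q * D.submatrix eB.symm eA.symm * P⁻¹) =
      Q * (B' * D).submatrix eB.symm eA.symm * P⁻¹ := by
    rw [← submatrix_mul_equiv _ _ _ eB.symm]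
    simp only [Matrix.mul_assoc]
    rw [nonsing_inv_mul_cancel_left _ _ hQ]
  rw [h₁, h₂]
  refine ⟨fun h => by rw [h], fun h => ?_⟩
  have := congrArg (fun X => (Q⁻¹ * X * P).submatrix eB eA) h
  simpa [Matrix.mul_assoc, nonsing_inv_mul_cancel_left _ _ hQ, nonsing_inv_mul _ hP] using this

end Intertwiner

section Toeplitz

/-- The `r × p` Toeplitz matrix whose `(b, a)` entry is `c (p - 1 - a + b)`, with `c` extended
by zero. -/
def toeplitz (p r s : ℕ) : (Fin s → ℂ) →ₗ[ℂ] Matrix (Fin r) (Fin p) ℂ where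
  toFun c := Matrix.of fun b a => if h : p - 1 - a + b < s then c ⟨p - 1 - a + b, h⟩ else 0
  map_add' c d := by
    ext b a
    simp only [of_apply, Matrix.add_apply, Pi.add_apply]
    split_ifs <;> simp
  map_smul' x c := by
    ext b a
    simp only [of_apply, Matrix.smul_apply, Pi.smul_apply, RingHom.id_apply]
    split_ifs <;> simp

variable {p r : ℕ}

theorem toeplitz_apply (s : ℕ) (c : Fin s → ℂ) (b : Fin r) (a : Fin p) :
    toeplitz p r s c b a =
      if h : p - 1 - a + b < s then c ⟨p - 1 - a + b, h⟩ else 0 := rfl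

theorem finrank_range_toeplitz {s : ℕ} (hs : s ≤ min p r) :
    Module.finrank ℂ (LinearMap.range (toeplitz p r s)) = s := by
  rw [LinearMap.finrank_range_of_inj, Module.finrank_fin_fun]
  intro c d h
  ext l
  have hl := l.2
  have := congrFun (congrFun h ⟨0, by omega⟩) ⟨p - 1 - l, by omega⟩
  simp only [toeplitz_apply] at this
  have e : p - 1 - (p - 1 - (l : ℕ)) + 0 = l := by omega
  simpa [e] using this

theorem rank_toeplitz_le {s : ℕ} (hs : s ≤ r) (c : Fin s → ℂ) : (toeplitz p r s c).rank ≤ s := by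
  have : toeplitz p r s c =
      (Matrix.of fun (b : Fin r) (x : Fin s) => if (x : ℕ) = b then (1 : ℂ) else 0) *
      (toeplitz p r s c).submatrix (Fin.castLE hs) id := by
    ext b a
    rw [Matrix.mul_apply]
    by_cases hb : (b : ℕ) < s
    · rw [Finset.sum_eq_single ⟨b, hb⟩]
      · simp [toeplitz_apply]
      · intro x _ hx
        rw [of_apply, if_neg (fun h => hx (Fin.ext h)), zero_mul]
      · simp
    · rw [Finset.sum_eq_zero, toeplitz_apply, dif_neg (by omega)]
      intro x _
      rw [of_apply, if_neg (by omega), zero_mul]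
  rw [this]
  exact (rank_mul_le_left _ _).trans (rank_le_width _)

theorem lt_rank_toeplitz {s : ℕ} (hs : s ≤ min p r) (c : Fin s → ℂ) (l : Fin s) (hl : c l ≠ 0)
    (hmax : ∀ x, l < x → c x = 0) : (l : ℕ) < (toeplitz p r s c).rank := by
  have hls := l.2
  set D := (toeplitz p r s c).submatrix (fun b : Fin (l + 1) => (⟨b, by omega⟩ : Fin r))
    (fun a : Fin (l + 1) => (⟨p - 1 - l + a, by omega⟩ : Fin p)) with hD
  have hdet : D.det = ∏ i, D i i := by
    refine det_of_isUpperTriangular ?_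
    intro b a hab
    have hab' : (a : ℕ) < b := hab
    simp only [hD, submatrix_apply, toeplitz_apply]
    split_ifs with h
    · exact hmax _ (by rw [Fin.lt_def]; simp only; omega)
    · rfl
  have hunit : IsUnit D := by
    rw [isUnit_iff_isUnit_det, isUnit_iff_ne_zero, hdet, Finset.prod_ne_zero_iff]
    intro i _
    have e : p - 1 - (p - 1 - (l : ℕ) + i) + i = l := by omega
    simpa [hD, toeplitz_apply, e] using hl
  have := rank_submatrix_le (toeplitz p r s c) (fun b : Fin (l + 1) => (⟨b, by omega⟩ : Fin r))
    (fun a : Fin (l + 1) => (⟨p - 1 - l + a, by omega⟩ : Fin p))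
  rw [← hD, rank_of_isUnit _ hunit, Fintype.card_fin] at this
  omega

theorem range_toeplitz_mono {s t : ℕ} (hst : s ≤ t) :
    LinearMap.range (toeplitz p r s) ≤ LinearMap.range (toeplitz p r t) := by
  rintro _ ⟨c, rfl⟩
  refine ⟨fun x => if h : (x : ℕ) < s then c ⟨x, h⟩ else 0, ?_⟩
  ext b a
  simp only [toeplitz_apply]
  split_ifs <;> first | rfl | omega

theorem mem_range_toeplitz_min {s k : ℕ} (hs : s ≤ min p r) (C : Matrix (Fin r) (Fin p) ℂ) :
    C ∈ LinearMap.range (toeplitz p r (min k s)) ↔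
      C ∈ LinearMap.range (toeplitz p r s) ∧ C.rank ≤ k := by
  constructor
  · intro h
    refine ⟨range_toeplitz_mono (min_le_right _ _) h, ?_⟩
    obtain ⟨c, rfl⟩ := h
    exact (rank_toeplitz_le (by omega) c).trans (min_le_left _ _)
  · rintro ⟨⟨c, rfl⟩, hk⟩
    have hc : ∀ l : Fin s, k ≤ l → c l = 0 := by
      by_contra! hcon
      obtain ⟨l, hkl, hl⟩ := hcon
      obtain ⟨x, hx, hmax⟩ := Finset.exists_max_image (Finset.univ.filter fun x => c x ≠ 0) id
        ⟨l, by simpa using hl⟩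
      have h₁ : l ≤ x := hmax l (by simpa using hl)
      have h₂ := lt_rank_toeplitz hs c x (by simpa using hx) fun y hy => by
        by_contra hy'
        exact absurd (hmax y (by simpa using hy')) (not_le.2 hy)
      have h₃ : (l : ℕ) ≤ x := h₁
      omega
    refine ⟨fun x => c (Fin.castLE (min_le_right _ _) x), ?_⟩
    ext b a
    simp only [toeplitz_apply]
    split_ifs with h₁ h₂ h₂
    · rfl
    · omega
    · exact (hc _ (by simp only; omega)).symm
    · rfl

end Toeplitz

section JordanBlock

variable {p r : ℕ}

theorem mul_JB_apply (C : Matrix (Fin r) (Fin p) ℂ) (lam : ℂ) (b : Fin r) (a : Fin p) :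
    (C * JB p lam) b a =
      lam * C b a + if 0 < (a : ℕ) then C b ⟨a - 1, by omega⟩ else 0 := by
  have h : ∀ x : Fin p, C b x * JB p lam x a =
      (if x = a then lam * C b a else 0) + if (a : ℕ) = x + 1 then C b x else 0 := by
    intro x
    simp only [JB, of_apply]
    by_cases h₁ : (a : ℕ) = x + 1
    · have : x ≠ a := by rintro rfl; omega
      simp [h₁, this]
    · by_cases h₂ : x = a
      · subst h₂; simp [mul_comm]
      · simp [h₁, h₂, Ne.symm h₂]
  rw [Matrix.mul_apply, Finset.sum_congr rfl fun x _ => h x, Finset.sum_add_distrib,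
    Finset.sum_ite_eq' Finset.univ a, if_pos (Finset.mem_univ _)]
  congr 1
  split_ifs with ha
  · rw [Finset.sum_eq_single ⟨a - 1, by omega⟩]
    · rw [if_pos (by simp only; omega)]
    · intro x _ hx
      rw [if_neg]
      intro h
      exact hx (Fin.ext (by simp only; omega))
    · simp
  · exact Finset.sum_eq_zero fun x _ => if_neg (by omega)

theorem JB_mul_apply (C : Matrix (Fin r) (Fin p) ℂ) (mu : ℂ) (b : Fin r) (a : Fin p) :
    (JB r mu * C) b a =
      mu * C b a + if h : (b : ℕ) + 1 < r then C ⟨b + 1, h⟩ a else 0 := by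
  have h : ∀ x : Fin r, JB r mu b x * C x a =
      (if x = b then mu * C b a else 0) + if (x : ℕ) = b + 1 then C x a else 0 := by
    intro x
    simp only [JB, of_apply]
    by_cases h₁ : (x : ℕ) = b + 1
    · have : x ≠ b := by rintro rfl; omega
      simp [h₁, this]
    · by_cases h₂ : x = b
      · subst h₂; simp
      · simp [h₁, h₂]
  rw [Matrix.mul_apply, Finset.sum_congr rfl fun x _ => h x, Finset.sum_add_distrib,
    Finset.sum_ite_eq' Finset.univ b, if_pos (Finset.mem_univ _)]
  congr 1
  split_ifs with hb
  · rw [Finset.sum_eq_single ⟨b + 1, hb⟩]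
    · simp
    · intro x _ hx
      rw [if_neg]
      intro h
      exact hx (Fin.ext h)
    · simp
  · exact Finset.sum_eq_zero fun x _ => if_neg (by omega)

theorem intertwiner_JB_of_ne {lam mu : ℂ} (h : lam ≠ mu) :
    intertwiner (JB p lam) (JB r mu) = ⊥ := by
  refine (Submodule.eq_bot_iff _).2 fun C hC => ?_
  rw [mem_intertwiner] at hC
  have key : ∀ d (b : Fin r) (a : Fin p), (a : ℕ) + (r - b) = d → C b a = 0 := by
    intro d
    induction d using Nat.strong_induction_on with
    | _ d ih =>
      intro b a hd
      have := congrFun (congrFun hC b) a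
      rw [mul_JB_apply, JB_mul_apply] at this
      have h₁ : (if 0 < (a : ℕ) then C b ⟨a - 1, by omega⟩ else 0) = 0 := by
        split_ifs with ha
        · exact ih (d - 1) (by omega) _ _ (by simp only; omega)
        · rfl
      have h₂ : (if h : (b : ℕ) + 1 < r then C ⟨b + 1, h⟩ a else 0) = 0 := by
        split_ifs with hb
        · exact ih (d - 1) (by omega) _ _ (by simp only; omega)
        · rfl
      rw [h₁, h₂, add_zero, add_zero, ← sub_eq_zero, ← sub_mul] at this
      exact (mul_eq_zero.1 this).resolve_left (sub_ne_zero.2 h)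
  ext b a
  exact key _ b a rfl

theorem intertwiner_JB_self (lam : ℂ) :
    intertwiner (JB p lam) (JB r lam) = LinearMap.range (toeplitz p r (min p r)) := by
  ext C
  rw [mem_intertwiner]
  constructor
  · intro hC
    have hrec : ∀ (b : Fin r) (a : Fin p),
        (if 0 < (a : ℕ) then C b ⟨a - 1, by omega⟩ else 0) =
          if h : (b : ℕ) + 1 < r then C ⟨b + 1, h⟩ a else 0 := by
      intro b a
      have := congrFun (congrFun hC b) a
      rw [mul_JB_apply, JB_mul_apply] at this
      exact add_left_cancel this
    have hzero : ∀ d b (hb : b < r) a (ha : a < p), r - b = d → a + r ≤ p - 1 + b →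
        C ⟨b, hb⟩ ⟨a, ha⟩ = 0 := by
      intro d
      induction d with
      | zero => intros; omega
      | succ d ih =>
        intro b hb a ha hd hab
        have := hrec ⟨b, hb⟩ ⟨a + 1, by omega⟩
        simp only [Nat.succ_pos, if_true, Nat.add_sub_cancel] at this
        rw [this]
        split_ifs with h
        · exact ih _ _ _ _ (by omega) (by omega)
        · rfl
    refine ⟨fun l => C ⟨0, by have := l.2; omega⟩ ⟨p - 1 - l, by have := l.2; omega⟩, ?_⟩
    have hval : ∀ b (hb : b < r) a (ha : a < p),
        C ⟨b, hb⟩ ⟨a, ha⟩ = if h : p - 1 - a + b < min p r then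
          C ⟨0, by omega⟩ ⟨p - 1 - (p - 1 - a + b), by omega⟩ else 0 := by
      intro b
      induction b with
      | zero =>
        intro hb a ha
        split_ifs with h
        · congr 1
          exact Fin.ext (by simp only; omega)
        · exact hzero _ _ _ _ _ rfl (by omega)
      | succ b ih =>
        intro hb a ha
        have := hrec ⟨b, by omega⟩ ⟨a, ha⟩
        simp only [hb, dif_pos] at this
        rw [← this]
        by_cases ha0 : 0 < a
        · rw [if_pos ha0, ih]
          have e : p - 1 - (a - 1) + b = p - 1 - a + (b + 1) := by omega
          simp only [e]
        · rw [if_neg ha0, dif_neg (by omega)]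
    ext b a
    exact (hval b b.2 a a.2).symm
  · rintro ⟨c, rfl⟩
    ext b a
    rw [mul_JB_apply, JB_mul_apply]
    congr 1
    simp only [toeplitz_apply]
    split_ifs with h₁ h₂ h₃ h₄ <;> first | rfl | omega | skip
    congr 1
    exact Fin.ext (by simp only; omega)

open scoped Classical in
theorem intertwiner_JB (lam mu : ℂ) :
    intertwiner (JB p lam) (JB r mu) =
      LinearMap.range (toeplitz p r (if lam = mu then min p r else 0)) := by
  by_cases h : lam = mu
  · rw [if_pos h, h, intertwiner_JB_self]
  · rw [if_neg h, intertwiner_JB_of_ne h, eq_comm, LinearMap.range_eq_bot]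
    ext
    simp [toeplitz_apply]

end JordanBlock

section Blocks

variable {ι κ : Type*} {α : ι → Type*} {β : κ → Type*}

/-- The block matrices whose `(j, i)` block lies in `W j i`. -/
def blockSubmodule (W : ∀ j i, Submodule ℂ (Matrix (β j) (α i) ℂ)) :
    Submodule ℂ (Matrix (Σ j, β j) (Σ i, α i) ℂ) where
  carrier := {C | ∀ j i, C.submatrix (Sigma.mk j) (Sigma.mk i) ∈ W j i}
  add_mem' hC hD j i := (W j i).add_mem (hC j i) (hD j i)
  zero_mem' j i := (W j i).zero_mem
  smul_mem' c _ hC j i := (W j i).smul_mem c (hC j i)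

theorem mem_blockSubmodule {W : ∀ j i, Submodule ℂ (Matrix (β j) (α i) ℂ)}
    {C : Matrix (Σ j, β j) (Σ i, α i) ℂ} :
    C ∈ blockSubmodule W ↔ ∀ j i, C.submatrix (Sigma.mk j) (Sigma.mk i) ∈ W j i := Iff.rfl

/-- A block matrix is the family of its blocks. -/
def blockSubmoduleEquiv (W : ∀ j i, Submodule ℂ (Matrix (β j) (α i) ℂ)) :
    blockSubmodule W ≃ₗ[ℂ] ∀ j i, W j i where
  toFun C j i := ⟨C.1.submatrix (Sigma.mk j) (Sigma.mk i), C.2 j i⟩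
  invFun D := ⟨Matrix.of fun x y => (D x.1 y.1).1 x.2 y.2, fun j i => (D j i).2⟩
  map_add' _ _ := rfl
  map_smul' _ _ := rfl
  left_inv _ := rfl
  right_inv _ := rfl

variable [Fintype ι] [Fintype κ] [∀ i, Fintype (α i)] [∀ j, Fintype (β j)]

theorem finrank_blockSubmodule (W : ∀ j i, Submodule ℂ (Matrix (β j) (α i) ℂ)) :
    Module.finrank ℂ (blockSubmodule W) = ∑ j, ∑ i, Module.finrank ℂ (W j i) := by
  rw [(blockSubmoduleEquiv W).finrank_eq, Module.finrank_pi_fintype]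
  exact Finset.sum_congr rfl fun j _ => Module.finrank_pi_fintype ℂ

variable [DecidableEq ι] [DecidableEq κ]

theorem intertwiner_blockDiagonal' (X : ∀ i, Matrix (α i) (α i) ℂ)
    (Y : ∀ j, Matrix (β j) (β j) ℂ) :
    intertwiner (blockDiagonal' X) (blockDiagonal' Y) =
      blockSubmodule fun j i => intertwiner (X i) (Y j) := by
  ext C
  simp only [mem_blockSubmodule, mem_intertwiner]
  have h₁ : ∀ j i, (C * blockDiagonal' X).submatrix (Sigma.mk j) (Sigma.mk i) =
      C.submatrix (Sigma.mk j) (Sigma.mk i) * X i := by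
    intro j i
    ext b a
    simp only [submatrix_apply, Matrix.mul_apply, Fintype.sum_sigma]
    rw [Finset.sum_eq_single i]
    · simp [blockDiagonal'_apply_eq]
    · intro i' _ hi'
      simp [blockDiagonal'_apply_ne X _ _ hi']
    · simp
  have h₂ : ∀ j i, (blockDiagonal' Y * C).submatrix (Sigma.mk j) (Sigma.mk i) =
      Y j * C.submatrix (Sigma.mk j) (Sigma.mk i) := by
    intro j i
    ext b a
    simp only [submatrix_apply, Matrix.mul_apply, Fintype.sum_sigma]
    rw [Finset.sum_eq_single j]
    · simp [blockDiagonal'_apply_eq]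
    · intro j' _ hj'
      simp [blockDiagonal'_apply_ne Y _ _ hj'.symm]
    · simp
  simp only [← h₁, ← h₂]
  refine ⟨fun h j i => by rw [h], fun h => ?_⟩
  ext ⟨j, b⟩ ⟨i, a⟩
  exact congrFun (congrFun (h j i) b) a

end Blocks

section SingleBlock

variable {ι κ : Type*} {α : ι → Type*} {β : κ → Type*} [DecidableEq ι] [DecidableEq κ]
  [∀ i, DecidableEq (α i)] [∀ j, DecidableEq (β j)]

theorem one_submatrix_sigmaMk_of_ne {j j' : κ} (h : j ≠ j') :
    (1 : Matrix (Σ j, β j) (Σ j, β j) ℂ).submatrix (Sigma.mk j) (Sigma.mk j') = 0 := by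
  ext b b'
  exact one_apply_ne fun h' => h (congrArg Sigma.fst h')

variable [∀ i, Fintype (α i)] [∀ j, Fintype (β j)]

/-- The block matrix whose only possibly nonzero block is `X`, in position `(j, i)`. -/
def singleBlock (j : κ) (i : ι) (X : Matrix (β j) (α i) ℂ) :
    Matrix (Σ j, β j) (Σ i, α i) ℂ :=
  (1 : Matrix (Σ j, β j) (Σ j, β j) ℂ).submatrix id (Sigma.mk j) * X *
    (1 : Matrix (Σ i, α i) (Σ i, α i) ℂ).submatrix (Sigma.mk i) id

theorem submatrix_singleBlock (j : κ) (i : ι) (X : Matrix (β j) (α i) ℂ) (j' : κ) (i' : ι) :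
    (singleBlock j i X).submatrix (Sigma.mk j') (Sigma.mk i') =
      (1 : Matrix (Σ j, β j) (Σ j, β j) ℂ).submatrix (Sigma.mk j') (Sigma.mk j) * X *
        (1 : Matrix (Σ i, α i) (Σ i, α i) ℂ).submatrix (Sigma.mk i) (Sigma.mk i') := rfl

theorem submatrix_singleBlock_self (j : κ) (i : ι) (X : Matrix (β j) (α i) ℂ) :
    (singleBlock j i X).submatrix (Sigma.mk j) (Sigma.mk i) = X := by
  rw [submatrix_singleBlock, submatrix_one _ sigma_mk_injective,
    submatrix_one _ sigma_mk_injective, Matrix.one_mul, Matrix.mul_one]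

theorem submatrix_singleBlock_of_ne {j j' : κ} {i i' : ι} (h : ¬(j' = j ∧ i' = i))
    (X : Matrix (β j) (α i) ℂ) :
    (singleBlock j i X).submatrix (Sigma.mk j') (Sigma.mk i') = 0 := by
  rw [submatrix_singleBlock]
  by_cases hj : j' = j
  · have hi : i ≠ i' := fun hi => h ⟨hj, hi.symm⟩
    rw [one_submatrix_sigmaMk_of_ne hi, Matrix.mul_zero]
  · rw [one_submatrix_sigmaMk_of_ne hj, Matrix.zero_mul, Matrix.zero_mul]

variable [Fintype ι]

theorem rank_singleBlock_le (j : κ) (i : ι) (X : Matrix (β j) (α i) ℂ) :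
    (singleBlock j i X).rank ≤ X.rank :=
  (rank_mul_le_left _ _).trans (rank_mul_le_right _ _)

variable [Fintype κ]

theorem sum_singleBlock (C : Matrix (Σ j, β j) (Σ i, α i) ℂ) :
    ∑ j, ∑ i, singleBlock j i (C.submatrix (Sigma.mk j) (Sigma.mk i)) = C := by
  ext ⟨j, b⟩ ⟨i, a⟩
  simp only [Matrix.sum_apply]
  have entry : ∀ j' i', singleBlock j' i' (C.submatrix (Sigma.mk j') (Sigma.mk i')) ⟨j, b⟩ ⟨i, a⟩ =
      (singleBlock j' i' (C.submatrix (Sigma.mk j') (Sigma.mk i'))).submatrix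
        (Sigma.mk j) (Sigma.mk i) b a := fun _ _ => rfl
  simp only [entry]
  rw [Finset.sum_eq_single j, Finset.sum_eq_single i, submatrix_singleBlock_self]
  · rfl
  · intro i' _ hi
    rw [submatrix_singleBlock_of_ne fun h => hi h.2.symm]
    rfl
  · simp
  · intro j' _ hj
    refine Finset.sum_eq_zero fun i' _ => ?_
    rw [submatrix_singleBlock_of_ne fun h => hj h.1.symm]
    rfl
  · simp

theorem span_blockSubmodule_rank_le {k : ℕ} {V W : ∀ j i, Submodule ℂ (Matrix (β j) (α i) ℂ)}
    (hVW : ∀ j i X, X ∈ V j i ↔ X ∈ W j i ∧ X.rank ≤ k) :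
    Submodule.span ℂ {C | C ∈ blockSubmodule W ∧ C.rank ≤ k} = blockSubmodule V := by
  refine le_antisymm (Submodule.span_le.2 ?_) fun C hC => ?_
  · rintro C ⟨hC, hk⟩ j i
    exact (hVW j i _).2 ⟨hC j i, (rank_submatrix_le _ _ _).trans hk⟩
  · rw [← sum_singleBlock C]
    refine Submodule.sum_mem _ fun j _ => Submodule.sum_mem _ fun i _ =>
      Submodule.subset_span ⟨fun j' i' => ?_, ?_⟩
    · by_cases h : j' = j ∧ i' = i
      · obtain ⟨rfl, rfl⟩ := h
        rw [submatrix_singleBlock_self]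
        exact ((hVW _ _ _).1 (hC _ _)).1
      · rw [submatrix_singleBlock_of_ne h]
        exact Submodule.zero_mem _
    · exact (rank_singleBlock_le _ _ _).trans ((hVW _ _ _).1 (hC j i)).2

end SingleBlock

open scoped Classical in
/-- `rd_k(im Δ)` for the generalized derivation `Δ(T) = AT − TB`,
where `A ≅ ⊕ᵢ J_{pᵢ}(λᵢ)` and `B ≅ ⊕ⱼ J_{rⱼ}(μⱼ)`. -/
theorem rdk_image_generalized_derivation (n k N M : ℕ) (hn : 0 < n) (hk : 0 < k)
    (p : Fin N → ℕ) (r : Fin M → ℕ) (lam : Fin N → ℂ) (mu : Fin M → ℂ)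
    (hp : ∑ i, p i = n) (hr : ∑ j, r j = n)
    (A B : Matrix (Fin n) (Fin n) ℂ)
    (eA : ((i : Fin N) × Fin (p i)) ≃ Fin n)
    (eB : ((j : Fin M) × Fin (r j)) ≃ Fin n)
    (hA : ∃ P : Matrix (Fin n) (Fin n) ℂ, IsUnit P ∧
      A = P * (Matrix.reindex eA eA (Matrix.blockDiagonal' fun i => JB (p i) (lam i))) * P⁻¹)
    (hB : ∃ Q : Matrix (Fin n) (Fin n) ℂ, IsUnit Q ∧
      B = Q * (Matrix.reindex eB eB (Matrix.blockDiagonal' fun j => JB (r j) (mu j))) * Q⁻¹) :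
    rdK k (Set.range fun T : Matrix (Fin n) (Fin n) ℂ => A * T - T * B) =
      ∑ i : Fin N, ∑ j : Fin M,
        if lam i = mu j ∧ k < min (p i) (r j) then min (p i) (r j) - k else 0 := by
  obtain ⟨P, hP, rfl⟩ := hA
  obtain ⟨Q, hQ, rfl⟩ := hB
  let s : Fin M → Fin N → ℕ := fun j i => if lam i = mu j then min (p i) (r j) else 0
  have hs : ∀ j i, s j i ≤ min (p i) (r j) := fun j i => by
    simp only [s]
    split_ifs <;> simp
  let φ := changeCoords hP hQ eA eB
  have hK : ∀ C, C ∈ intertwiner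
      (P * reindex eA eA (blockDiagonal' fun i => JB (p i) (lam i)) * P⁻¹)
      (Q * reindex eB eB (blockDiagonal' fun j => JB (r j) (mu j)) * Q⁻¹) ↔
      φ C ∈ blockSubmodule fun j i => LinearMap.range (toeplitz (p i) (r j) (s j i)) := by
    intro C
    rw [← changeCoords_mem_intertwiner, intertwiner_blockDiagonal']
    simp only [intertwiner_JB]
    rfl
  have hdim : ∀ (S : Set (Matrix (Fin n) (Fin n) ℂ))
      (S' : Set (Matrix ((j : Fin M) × Fin (r j)) ((i : Fin N) × Fin (p i)) ℂ)),
      (∀ C, C ∈ S ↔ φ C ∈ S') → Module.finrank ℂ (Submodule.span ℂ S) =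
        Module.finrank ℂ (Submodule.span ℂ S') := by
    intro S S' h
    have : S' = φ '' S := by
      ext D
      obtain ⟨C, rfl⟩ := φ.surjective D
      rw [φ.injective.mem_set_image, h]
    rw [this, ← LinearEquiv.coe_coe, Submodule.span_image, LinearEquiv.finrank_map_eq]
  have hrank : ∀ C, C.rank ≤ k ↔ (φ C).rank ≤ k := fun C => by rw [rank_changeCoords]
  rw [rdK_eq, annih_range_derivation, hdim _ _ hK,
    hdim _ {D | D ∈ blockSubmodule (fun j i => LinearMap.range (toeplitz (p i) (r j) (s j i))) ∧
      D.rank ≤ k} (by exact fun C => and_congr (hK C) (hrank C)),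
    span_blockSubmodule_rank_le fun j i X => mem_range_toeplitz_min (hs j i) X]
  rw [Submodule.span_eq, finrank_blockSubmodule, finrank_blockSubmodule]
  simp only [finrank_range_toeplitz (hs _ _),
    finrank_range_toeplitz ((min_le_right k _).trans (hs _ _))]
  have hsum : ∑ j, ∑ i, s j i = ∑ j, ∑ i, min k (s j i) + ∑ j, ∑ i,
      if lam i = mu j ∧ k < min (p i) (r j) then min (p i) (r j) - k else 0 := by
    simp only [← Finset.sum_add_distrib]
    refine Finset.sum_congr rfl fun j _ => Finset.sum_congr rfl fun i _ => ?_
    simp only [s]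
    by_cases h : lam i = mu j
    · simp only [h, true_and, if_true]
      split_ifs <;> omega
    · simp [h]
  rw [hsum, Nat.add_sub_cancel_left, Finset.sum_comm]
end

section
/- Let A, B ∈ M_n(ℂ) and Δ(T) = AT − TB on M_n(ℂ). Then im Δ is k-reflexive if and only if every root of the greatest common divisor of the minimal polynomials of A and B has multiplicity at most k. -/
open Matrix

open Polynomial Module

/-- An endomorphism of a finite-dimensional complex space splits the space into cyclic summands,
each generated by a generalized eigenvector. -/
theorem exists_cyclic_decomposition {V : Type*} [AddCommGroup V] [Module ℂ V]
    [FiniteDimensional ℂ V] (a : End ℂ V) :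
    ∃ (ι : Type) (_ : Fintype ι) (P : ι → End ℂ V) (w : ι → V) (z : ι → ℂ) (e : ι → ℕ),
      ∑ i, P i = 1 ∧ (∀ i, P i * a = a * P i) ∧
      (∀ i x, ∃ q : ℂ[X], P i x = aeval a q (w i)) ∧
      ∀ i, aeval a ((X - C (z i)) ^ e i) (w i) = 0 := by
  classical
  obtain ⟨ι, _, p, hp, e, ⟨E⟩⟩ := Module.equiv_directSum_of_isTorsion
    (AEval.isTorsion_of_finiteDimensional ℂ V a)
  have hz (i : ι) : ∃ z, Associated (p i) (X - C z) := by
    have h1 := IsAlgClosed.degree_eq_one_of_irreducible ℂ (hp i)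
    obtain ⟨z, hz⟩ := Polynomial.exists_root_of_degree_eq_one h1
    refine ⟨z, ((Polynomial.irreducible_X_sub_C z).associated_of_dvd (hp i)
      (Polynomial.dvd_iff_isRoot.mpr hz)).symm⟩
  choose z hz using hz
  let Q (i : ι) : AEval ℂ V a →ₗ[ℂ[X]] AEval ℂ V a :=
    E.symm.toLinearMap ∘ₗ DirectSum.lof ℂ[X] ι (fun i => ℂ[X] ⧸ ℂ[X] ∙ p i ^ e i) i ∘ₗ
      DirectSum.component ℂ[X] ι (fun i => ℂ[X] ⧸ ℂ[X] ∙ p i ^ e i) i ∘ₗ E.toLinearMap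
  let o := AEval.of ℂ V a
  have ho (q : ℂ[X]) (x : V) : o (aeval a q x) = q • o x := AEval.of_aeval_smul a q x
  let W (i : ι) : AEval ℂ V a := E.symm (DirectSum.lof ℂ[X] ι
    (fun i => ℂ[X] ⧸ ℂ[X] ∙ p i ^ e i) i (Submodule.Quotient.mk 1))
  have hQ (i : ι) (x) : ∃ q : ℂ[X], Q i x = q • W i := by
    obtain ⟨q, hq⟩ := Submodule.Quotient.mk_surjective _
      (DirectSum.component ℂ[X] ι (fun i => ℂ[X] ⧸ ℂ[X] ∙ p i ^ e i) i (E x))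
    refine ⟨q, ?_⟩
    simp only [Q, W, LinearMap.comp_apply, LinearEquiv.coe_coe, ← hq, ← map_smul,
      ← Submodule.Quotient.mk_smul, smul_eq_mul, mul_one]
  have hW (i : ι) : (X - C (z i)) ^ e i • W i = 0 := by
    simp only [W, ← map_smul, ← Submodule.Quotient.mk_smul, smul_eq_mul, mul_one]
    rw [(Submodule.Quotient.mk_eq_zero _).mpr, map_zero, map_zero]
    exact Ideal.mem_span_singleton.mpr ((hz i).pow_pow (n := e i)).dvd
  have hsum (x) : ∑ i, Q i x = x := by
    simp only [Q, LinearMap.comp_apply, LinearEquiv.coe_coe, ← map_sum]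
    rw [LinearEquiv.symm_apply_eq]
    ext j
    simp [DirectSum.component, DirectSum.lof_eq_of, DirectSum.sum_apply, DirectSum.of_apply]
    rfl
  refine ⟨ι, inferInstance,
    fun i => o.symm.toLinearMap ∘ₗ (Q i).restrictScalars ℂ ∘ₗ o.toLinearMap,
    fun i => o.symm (W i), z, e, ?_, ?_, ?_, ?_⟩
  · ext x
    apply o.injective
    simpa [LinearMap.sum_apply, map_sum] using hsum (o x)
  · intro i
    ext x
    apply o.injective
    have h1 (x : V) : o (a x) = (X : ℂ[X]) • o x := by simpa using ho X x
    simp [h1]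
  · intro i x
    obtain ⟨q, hq⟩ := hQ i (o x)
    refine ⟨q, o.injective ?_⟩
    simp [ho, hq]
  · intro i
    apply o.injective
    rw [ho]
    simpa using hW i

section Intertwiner

variable {V W : Type*} [AddCommGroup V] [Module ℂ V] [AddCommGroup W] [Module ℂ W]

theorem intertwiner_aeval {a : End ℂ V} {b : End ℂ W} {f : V →ₗ[ℂ] W} (h : f ∘ₗ a = b ∘ₗ f)
    (q : ℂ[X]) (x : V) : f (aeval a q x) = aeval b q (f x) := by
  have h' (x : V) : f (a x) = b (f x) := LinearMap.congr_fun h x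
  induction q using Polynomial.induction_on' generalizing x with
  | add p q hp hq => simp [hp, hq]
  | monomial n c =>
    have hn (x : V) : f ((a ^ n) x) = (b ^ n) (f x) := by
      induction n generalizing x with
      | zero => simp
      | succ n ih => simp [pow_succ, ih, h']
    simp [aeval_monomial, hn]

theorem finrank_range_le_of_cyclic {b : End ℂ W} {g : V →ₗ[ℂ] W} {v : W} {z : ℂ} {k : ℕ}
    (hg : ∀ x, ∃ q : ℂ[X], g x = aeval b q v) (hv : aeval b ((X - C z) ^ k) v = 0) :
    finrank ℂ (LinearMap.range g) ≤ k := by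
  let L : degreeLT ℂ k →ₗ[ℂ] W :=
    (LinearMap.applyₗ v ∘ₗ (aeval b).toLinearMap) ∘ₗ (degreeLT ℂ k).subtype
  have hle : LinearMap.range g ≤ LinearMap.range L := by
    rintro _ ⟨x, rfl⟩
    obtain ⟨q, hq⟩ := hg x
    have hm : ((X - C z) ^ k : ℂ[X]).Monic := (monic_X_sub_C z).pow k
    refine ⟨⟨q %ₘ (X - C z) ^ k, ?_⟩, ?_⟩
    · rw [mem_degreeLT]
      simpa using degree_modByMonic_lt q hm
    · rw [hq]
      conv_rhs => rw [← modByMonic_add_div q ((X - C z) ^ k), mul_comm ((X - C z) ^ k)]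
      rw [map_add, map_mul, LinearMap.add_apply, Module.End.mul_apply, hv, map_zero, add_zero]
      rfl
  have : FiniteDimensional ℂ (degreeLT ℂ k) :=
    Module.Finite.equiv (degreeLTEquiv ℂ k).symm
  calc finrank ℂ (LinearMap.range g) ≤ finrank ℂ (LinearMap.range L) :=
        Submodule.finrank_mono hle
    _ ≤ finrank ℂ (degreeLT ℂ k) := LinearMap.finrank_range_le L
    _ = k := by rw [(degreeLTEquiv ℂ k).finrank_eq]; simp

theorem aeval_X_sub_C_pow_eq_zero {b : End ℂ W} {v : W} {z : ℂ} {e k : ℕ} {g : ℂ[X]}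
    (hg0 : g ≠ 0) (hk : g.rootMultiplicity z ≤ k) (he : aeval b ((X - C z) ^ e) v = 0)
    (hgv : aeval b g v = 0) : aeval b ((X - C z) ^ k) v = 0 := by
  obtain ⟨h, hgh, hdvd⟩ := exists_eq_pow_rootMultiplicity_mul_and_not_dvd g hg0 z
  set r := g.rootMultiplicity z
  obtain ⟨s, t, hst⟩ : IsCoprime ((X - C z) ^ e) h :=
    ((irreducible_X_sub_C z).coprime_iff_not_dvd.mpr hdvd).pow_left
  have : (X - C z) ^ k =
      (X - C z) ^ k * s * (X - C z) ^ e + (X - C z) ^ (k - r) * t * g := by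
    conv_rhs => rw [hgh]
    conv_lhs => rw [← mul_one ((X - C z) ^ k), ← hst]
    rw [mul_add, ← mul_assoc, show (X - C z) ^ k = (X - C z) ^ (k - r) * (X - C z) ^ r by
      rw [← pow_add, Nat.sub_add_cancel hk]]
    ring
  rw [this, map_add, map_mul, map_mul _ _ g, LinearMap.add_apply, Module.End.mul_apply,
    Module.End.mul_apply, he, hgv, map_zero, map_zero, add_zero]

/-- If the common roots of the minimal polynomials have multiplicity at most `k`, every intertwiner
is a sum of intertwiners of rank at most `k`. -/
theorem exists_sum_intertwiner_of_rootMultiplicity_le [FiniteDimensional ℂ V] {k : ℕ}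
    {a : End ℂ V} {b : End ℂ W}
    (hk : ∀ z, (EuclideanDomain.gcd (minpoly ℂ a) (minpoly ℂ b)).rootMultiplicity z ≤ k)
    {f : V →ₗ[ℂ] W} (hf : f ∘ₗ a = b ∘ₗ f) :
    ∃ (ι : Type) (_ : Fintype ι) (g : ι → V →ₗ[ℂ] W), ∑ i, g i = f ∧
      ∀ i, g i ∘ₗ a = b ∘ₗ g i ∧ finrank ℂ (LinearMap.range (g i)) ≤ k := by
  obtain ⟨ι, _, P, w, z, e, hsum, hcomm, hcyc, hw⟩ := exists_cyclic_decomposition a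
  refine ⟨ι, inferInstance, fun i => f ∘ₗ P i, ?_, fun i => ⟨?_, ?_⟩⟩
  · ext x
    have := LinearMap.congr_fun hsum x
    simp only [LinearMap.sum_apply, LinearMap.comp_apply, ← map_sum] at this ⊢
    rw [this, Module.End.one_apply]
  · have := hcomm i
    simp only [Module.End.mul_eq_comp] at this
    rw [LinearMap.comp_assoc, this, ← LinearMap.comp_assoc, hf, LinearMap.comp_assoc]
  · have hg0 : EuclideanDomain.gcd (minpoly ℂ a) (minpoly ℂ b) ≠ 0 := fun h =>
      minpoly.ne_zero_of_finite ℂ a (EuclideanDomain.gcd_eq_zero_iff.mp h).1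
    refine finrank_range_le_of_cyclic (b := b) (v := f (w i)) (z := z i) (fun x => ?_)
      (aeval_X_sub_C_pow_eq_zero (e := e i) hg0 (hk (z i)) ?_ ?_)
    · obtain ⟨q, hq⟩ := hcyc i x
      exact ⟨q, by rw [LinearMap.comp_apply, hq, intertwiner_aeval hf]⟩
    · rw [← intertwiner_aeval hf, hw, map_zero]
    · rw [EuclideanDomain.gcd_eq_gcd_ab, map_add, LinearMap.add_apply, mul_comm, map_mul,
        mul_comm (minpoly ℂ b), map_mul, minpoly.aeval, Module.End.mul_apply,
        ← intertwiner_aeval hf, minpoly.aeval]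
      simp

theorem pow_apply_eq_zero_of_finrank_range_le [FiniteDimensional ℂ V] {k p : ℕ}
    {N : End ℂ W} {M : End ℂ V}
    {g : V →ₗ[ℂ] W} (hg : g ∘ₗ M = N ∘ₗ g) (hk : finrank ℂ (LinearMap.range g) ≤ k) {u : V}
    (hu : (M ^ p) u = 0) : (N ^ k) (g u) = 0 := by
  have hg' (x : V) : g (M x) = N (g x) := LinearMap.congr_fun hg x
  have hinv : ∀ y ∈ LinearMap.range g, N y ∈ LinearMap.range g := by
    rintro _ ⟨x, rfl⟩
    exact ⟨M x, hg' x⟩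
  have hpow (x : V) : g ((M ^ p) x) = (N ^ p) (g x) := by
    clear hu
    induction p generalizing x with
    | zero => simp
    | succ n ih => simp [pow_succ, ih, hg']
  let N' := N.restrict hinv
  let y : LinearMap.range g := ⟨g u, u, rfl⟩
  have h1 : y ∈ LinearMap.ker (N' ^ p) := by
    rw [LinearMap.mem_ker, Module.End.pow_restrict]
    ext
    simp [y, LinearMap.restrict_apply, ← hpow, hu]
  have h2 := Module.End.ker_pow_le_ker_pow_finrank N' p h1
  have h3 : y ∈ LinearMap.ker (N' ^ k) := by
    rw [LinearMap.mem_ker] at h2 ⊢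
    rw [← Nat.sub_add_cancel hk, pow_add, Module.End.mul_apply, h2, map_zero]
  rw [LinearMap.mem_ker, Module.End.pow_restrict] at h3
  simpa [y, LinearMap.restrict_apply] using congrArg Subtype.val h3

theorem exists_aeval_minpoly_factor_ne_zero [FiniteDimensional ℂ V] {a : End ℂ V} {z : ℂ} {k : ℕ}
    (h : (X - C z) ^ (k + 1) ∣ minpoly ℂ a) :
    ∃ q : ℂ[X], aeval a ((X - C z) ^ (k + 1) * q) = 0 ∧ aeval a ((X - C z) ^ k * q) ≠ 0 := by
  obtain ⟨q, hq⟩ := h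
  refine ⟨q, by rw [← hq, minpoly.aeval], fun h0 => ?_⟩
  have hne := minpoly.ne_zero_of_finite ℂ a
  have hd := minpoly.dvd ℂ a h0
  rw [hq, pow_succ, mul_right_comm] at hd
  rw [hq, pow_succ, mul_right_comm] at hne
  refine (irreducible_X_sub_C z).not_isUnit (isUnit_of_dvd_one ?_)
  refine (mul_dvd_mul_iff_left (left_ne_zero_of_mul hne)).mp ?_
  rwa [mul_one]

/-- If the minimal polynomials share a root of multiplicity exceeding `k`, some rank-one functional
vanishes on the intertwiners of rank at most `k`, but not on all intertwiners. -/
theorem exists_separating_of_pow_dvd [FiniteDimensional ℂ V] [FiniteDimensional ℂ W]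
    {k : ℕ} {a : End ℂ V} {b : End ℂ W} {z : ℂ}
    (ha : (X - C z) ^ (k + 1) ∣ minpoly ℂ a) (hb : (X - C z) ^ (k + 1) ∣ minpoly ℂ b) :
    ∃ (u : V) (ψ : Dual ℂ W),
      (∀ g : V →ₗ[ℂ] W, g ∘ₗ a = b ∘ₗ g → finrank ℂ (LinearMap.range g) ≤ k → ψ (g u) = 0) ∧
      ∃ f : V →ₗ[ℂ] W, f ∘ₗ a = b ∘ₗ f ∧ ψ (f u) ≠ 0 := by
  set M : End ℂ V := aeval a (X - C z) with hM
  set N : End ℂ W := aeval b (X - C z) with hN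
  obtain ⟨s, hs0, hs⟩ := exists_aeval_minpoly_factor_ne_zero ha
  obtain ⟨t, ht0, ht⟩ := exists_aeval_minpoly_factor_ne_zero hb
  obtain ⟨x, hx⟩ : ∃ x, aeval a ((X - C z) ^ k * s) x ≠ 0 := by
    by_contra! h
    exact hs (LinearMap.ext h)
  obtain ⟨y, hy⟩ : ∃ y, aeval b ((X - C z) ^ k * t) y ≠ 0 := by
    by_contra! h
    exact ht (LinearMap.ext h)
  obtain ⟨φ₀, hφ₀⟩ : ∃ φ : Dual ℂ V, φ (aeval a ((X - C z) ^ k * s) x) ≠ 0 := by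
    by_contra! h
    exact hx ((Module.forall_dual_apply_eq_zero_iff ℂ _).mp h)
  obtain ⟨ψ₀, hψ₀⟩ : ∃ ψ : Dual ℂ W, ψ (aeval b ((X - C z) ^ k * t) y) ≠ 0 := by
    by_contra! h
    exact hy ((Module.forall_dual_apply_eq_zero_iff ℂ _).mp h)
  let φ : Dual ℂ V := φ₀ ∘ₗ aeval a s
  let v : W := aeval b t y
  have hφ (x : V) : φ ((M ^ (k + 1)) x) = 0 := by
    have : (aeval a s) ((M ^ (k + 1)) x) = 0 := by
      rw [hM, ← map_pow, ← Module.End.mul_apply, ← map_mul, mul_comm, hs0, LinearMap.zero_apply]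
    simp [φ, this]
  have hv : (N ^ (k + 1)) v = 0 := by
    rw [hN, ← map_pow, ← Module.End.mul_apply, ← map_mul, ht0, LinearMap.zero_apply]
  have hφx : φ ((M ^ k) x) ≠ 0 := by
    simp only [φ, LinearMap.comp_apply, hM]
    rwa [← map_pow, ← Module.End.mul_apply, ← map_mul, mul_comm]
  have hψv : ψ₀ ((N ^ k) v) ≠ 0 := by
    rwa [hN, ← map_pow, ← Module.End.mul_apply, ← map_mul]
  obtain ⟨h, hah, hdvd⟩ := exists_eq_pow_rootMultiplicity_mul_and_not_dvd (minpoly ℂ a)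
    (minpoly.ne_zero_of_finite ℂ a) z
  obtain ⟨c, d, hcd⟩ : IsCoprime ((X - C z) ^ (k + 1)) h :=
    ((irreducible_X_sub_C z).coprime_iff_not_dvd.mpr hdvd).pow_left
  let u : V := aeval a (d * h) x
  have hu : (M ^ (minpoly ℂ a).rootMultiplicity z) u = 0 := by
    rw [hM, ← map_pow, ← Module.End.mul_apply, ← map_mul, mul_left_comm, ← hah, map_mul,
      minpoly.aeval, mul_zero, LinearMap.zero_apply]
  have hxu : x = (M ^ (k + 1)) (aeval a c x) + u := by
    rw [hM, ← map_pow, ← Module.End.mul_apply, ← map_mul, ← LinearMap.add_apply, ← map_add,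
      mul_comm _ c, hcd, map_one, Module.End.one_apply]
  clear_value u v
  have hφu : φ ((M ^ k) u) = φ ((M ^ k) x) := by
    conv_rhs => rw [hxu, map_add, map_add]
    rw [← Module.End.mul_apply, ← pow_add, add_comm k (k + 1), pow_add, Module.End.mul_apply,
      hφ, zero_add]
  refine ⟨u, ψ₀ ∘ₗ (N ^ k), fun g hg hgk => ?_, ?_⟩
  · rw [LinearMap.comp_apply, pow_apply_eq_zero_of_finrank_range_le (N := N) (M := M) ?_ hgk hu,
      map_zero]
    ext y
    exact intertwiner_aeval hg _ y
  · let f : V →ₗ[ℂ] W :=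
      ∑ i ∈ Finset.range (k + 1), (φ ∘ₗ (M ^ (k - i))).smulRight ((N ^ i) v)
    have hfx (x : V) : f x = ∑ i ∈ Finset.range (k + 1), φ ((M ^ (k - i)) x) • (N ^ i) v := by
      simp [f]
    have hfM (x : V) : f (M x) = N (f x) := by
      rw [hfx, hfx, map_sum, Finset.sum_range_succ', Finset.sum_range_succ]
      have h1 : φ ((M ^ (k - 0)) (M x)) = 0 := by
        rw [Nat.sub_zero, ← Module.End.mul_apply, ← pow_succ, hφ]
      have h2 : N ((N ^ k) v) = 0 := by
        rw [← Module.End.mul_apply, ← pow_succ', hv]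
      rw [h1, map_smul, h2, zero_smul, smul_zero]
      congr 1
      refine Finset.sum_congr rfl fun i hi => ?_
      rw [map_smul, ← Module.End.mul_apply, ← Module.End.mul_apply, ← pow_succ, ← pow_succ']
      congr 4
      have := Finset.mem_range.mp hi
      omega
    refine ⟨f, ?_, ?_⟩
    · ext x
      have := hfM x
      simp only [hM, hN, map_sub, aeval_X, aeval_C, LinearMap.sub_apply,
        Module.algebraMap_end_apply, map_smul] at this
      exact sub_left_injective this
    · rw [LinearMap.comp_apply, hfx, Finset.sum_range_succ', map_add, map_sum, Finset.sum_eq_zero]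
      · simpa [hφu] using ⟨hφx, hψv⟩
      · intro i _
        rw [map_smul, ← Module.End.mul_apply, ← pow_add,
          show k + (i + 1) = i + (k + 1) by omega, pow_add, Module.End.mul_apply, hv, map_zero,
          smul_zero]

end Intertwiner

theorem mem_annih_range_iff {n : ℕ} (A B D : Matrix (Fin n) (Fin n) ℂ) :
    D ∈ annih (Set.range fun T : Matrix (Fin n) (Fin n) ℂ => A * T - T * B) ↔
      toLin' D ∘ₗ toLin' A = toLin' B ∘ₗ toLin' D := by
  have key (T : Matrix (Fin n) (Fin n) ℂ) :
      (D * (A * T - T * B)).trace = (D * A * T).trace - (B * D * T).trace := by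
    rw [mul_sub, trace_sub, ← Matrix.mul_assoc, ← Matrix.mul_assoc, trace_mul_comm (D * T) B,
      ← Matrix.mul_assoc]
  rw [← toLin'_mul, ← toLin'_mul, toLin'.injective.eq_iff, Matrix.ext_iff_trace_mul_right]
  simp only [annih, Set.mem_ofPred_eq, Set.forall_mem_range, key, sub_eq_zero]

/-- A subspace of matrices equals its double annihilator for the trace pairing. -/
theorem annih_annih_submodule {n : ℕ} (S : Submodule ℂ (Matrix (Fin n) (Fin n) ℂ)) :
    annih (annih (S : Set (Matrix (Fin n) (Fin n) ℂ))) = S := by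
  ext Y
  refine ⟨fun hY => ?_, fun hY D hD => by rw [trace_mul_comm]; exact hD Y hY⟩
  by_contra hYS
  obtain ⟨f, hfY, hf⟩ := Submodule.exists_le_ker_of_notMem hYS
  let D : Matrix (Fin n) (Fin n) ℂ := Matrix.of fun i j => f (Matrix.single j i 1)
  have hD (T : Matrix (Fin n) (Fin n) ℂ) : (D * T).trace = f T := by
    conv_rhs => rw [matrix_eq_sum_single T]
    simp only [map_sum, trace, diag, mul_apply, D, of_apply]
    rw [Finset.sum_comm]
    refine Finset.sum_congr rfl fun i _ => Finset.sum_congr rfl fun j _ => ?_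
    rw [← mul_one (T i j), ← smul_eq_mul (T i j) 1, ← smul_single, map_smul, smul_eq_mul,
      smul_eq_mul, mul_one, mul_comm]
  refine hfY ?_
  rw [← hD, trace_mul_comm]
  exact hY D fun T hT => by rw [hD]; exact hf hT

/-- `im Δ` for `Δ(T) = AT − TB` is `k`-reflexive iff every root of
`gcd(m_A, m_B)` (the minimal polynomials of `A` and `B`) has multiplicity at
most `k`. -/
theorem image_generalized_derivation_reflexive_iff (n k : ℕ) (hn : 0 < n) (hk : 0 < k)
    (A B : Matrix (Fin n) (Fin n) ℂ) :
    RefK k (Set.range fun T : Matrix (Fin n) (Fin n) ℂ => A * T - T * B) =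
        (Set.range fun T : Matrix (Fin n) (Fin n) ℂ => A * T - T * B) ↔
      ∀ z : ℂ, (EuclideanDomain.gcd (minpoly ℂ A) (minpoly ℂ B)).rootMultiplicity z ≤ k := by
  let S : Submodule ℂ (Matrix (Fin n) (Fin n) ℂ) :=
    LinearMap.range (LinearMap.mulLeft ℂ A - LinearMap.mulRight ℂ B)
  have hS : (Set.range fun T : Matrix (Fin n) (Fin n) ℂ => A * T - T * B) = S := by
    ext; simp [S]
  have hAB := mem_annih_range_iff A B
  have hdouble := annih_annih_submodule S
  rw [← hS] at hdouble
  set R := Set.range fun T : Matrix (Fin n) (Fin n) ℂ => A * T - T * B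
  constructor
  · intro h z
    by_contra! hz
    have hg0 : EuclideanDomain.gcd (minpoly ℂ A) (minpoly ℂ B) ≠ 0 := fun h =>
      minpoly.ne_zero_of_finite ℂ A (EuclideanDomain.gcd_eq_zero_iff.mp h).1
    have hdvd := (le_rootMultiplicity_iff hg0).mp (Nat.succ_le_of_lt hz)
    obtain ⟨u, ψ, hψ, f, hf, hfu⟩ := exists_separating_of_pow_dvd (k := k)
      (a := toLin' A) (b := toLin' B) (z := z)
      (by rw [minpoly_toLin']; exact hdvd.trans (EuclideanDomain.gcd_dvd_left _ _))
      (by rw [minpoly_toLin']; exact hdvd.trans (EuclideanDomain.gcd_dvd_right _ _))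
    let Y : Matrix (Fin n) (Fin n) ℂ := vecMulVec u fun j => ψ (Pi.single j 1)
    have hY (D : Matrix (Fin n) (Fin n) ℂ) : (Y * D).trace = ψ (toLin' D u) := by
      rw [trace_mul_comm, mul_vecMulVec, trace_vecMulVec, toLin'_apply]
      conv_rhs => rw [pi_eq_sum_univ' (D *ᵥ u)]
      simp [dotProduct]
    have hmem : Y ∈ RefK k R := fun D hD => by
      rw [hY]
      exact hψ _ ((hAB D).mp hD.1) hD.2
    rw [h, ← hdouble] at hmem
    refine hfu ?_
    have := hmem (LinearMap.toMatrix' f) ((hAB _).mpr (by simpa using hf))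
    rwa [hY, toLin'_toMatrix'] at this
  · intro h
    refine Set.Subset.antisymm (fun Y hY => ?_) fun Y hY D hD => ?_
    · rw [← hdouble]
      intro D hD
      obtain ⟨ι, _, g, hsum, hg⟩ := exists_sum_intertwiner_of_rootMultiplicity_le (k := k)
        (by simpa only [minpoly_toLin'] using h) ((hAB D).mp hD)
      have hD : D = ∑ i, LinearMap.toMatrix' (g i) := by
        rw [← map_sum, hsum, LinearMap.toMatrix'_toLin']
      rw [hD, Matrix.mul_sum, trace_sum]
      refine Finset.sum_eq_zero fun i _ => hY _ ⟨(hAB _).mpr ?_, ?_⟩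
      · simpa using (hg i).1
      · rw [Matrix.rank, ← toLin'_apply', toLin'_toMatrix']
        exact (hg i).2
    · rw [trace_mul_comm]
      exact hD.1 Y hY
end
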